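/- For every λ > 0 and every u in X_{λ,A} one has the scale-dependent Poincaré inequality with monomial Gaussian weight: ∫_{ℝ^N_*} |∇u|² dμ_{A,λ} ≥ (1/λ²) inf over c ∈ ℝ of ∫_{ℝ^N_*} |u − c|² dμ_{A,λ}. -/

import Mathlib

open MeasureTheory Real

noncomputable section

/-- The Weyl chamber associated to the monomial weight with exponents `α`. -/
def chamber {N : ℕ} (α : Fin N → ℝ) : Set (EuclideanSpace ℝ (Fin N)) :=
  {x | ∀ i, 0 < α i → 0 < x i}

/-- The monomial weight `x^A = x₁^{α₁} ⋯ x_N^{α_N}`. -/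
def monWeight {N : ℕ} (α : Fin N → ℝ) (x : EuclideanSpace ℝ (Fin N)) : ℝ :=
  ∏ i, x i ^ α i

/-- The scale-dependent monomial Gaussian probability measure
`dμ_{A,λ} = x^A e^{-|x|²/(2λ²)} dx / ∫_{ℝ^N_*} x^A e^{-|x|²/(2λ²)} dx`. -/
def monGaussScaled {N : ℕ} (α : Fin N → ℝ) (lam : ℝ) : Measure (EuclideanSpace ℝ (Fin N)) :=
  (((MeasureTheory.volume.restrict (chamber α)).withDensity
      (fun x => ENNReal.ofReal (monWeight α x * Real.exp (-‖x‖ ^ 2 / (2 * lam ^ 2))))) Set.univ)⁻¹ •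
  ((MeasureTheory.volume.restrict (chamber α)).withDensity
      (fun x => ENNReal.ofReal (monWeight α x * Real.exp (-‖x‖ ^ 2 / (2 * lam ^ 2)))))

/-- Membership in the class `N_*`: smooth, compactly supported, with vanishing normal
component of the gradient on the boundary of the Weyl chamber. -/
def NstarClass {N : ℕ} (α : Fin N → ℝ) (u : EuclideanSpace ℝ (Fin N) → ℝ) : Prop :=
  ContDiff ℝ (⊤ : ℕ∞) u ∧ HasCompactSupport u ∧
    ∀ x : EuclideanSpace ℝ (Fin N), ∀ i, 0 < α i → x i = 0 →
      fderiv ℝ u x (EuclideanSpace.single i 1) = 0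

end

theorem sq_sub_le_mul_integral_deriv_sq {f : ℝ → ℝ} (hf : ContDiff ℝ 1 f) {y x : ℝ} (hxy : y < x) :
    (f x - f y) ^ 2 ≤ (x - y) * ∫ t in y..x, deriv f t ^ 2 := by
  have hc : Continuous (deriv f) := hf.continuous_deriv le_rfl
  have hd : ∫ t in y..x, deriv f t = f x - f y :=
    intervalIntegral.integral_deriv_eq_sub (fun t _ => hf.differentiable one_ne_zero t)
      (hc.intervalIntegrable _ _)
  have hpos : 0 < x - y := sub_pos.2 hxy
  set c := (f x - f y) / (x - y) with hcdef
  have h0 : 0 ≤ ∫ t in y..x, (deriv f t - c) ^ 2 :=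
    intervalIntegral.integral_nonneg hxy.le fun t _ => sq_nonneg _
  have h1 : ∫ t in y..x, (deriv f t - c) ^ 2 =
      (∫ t in y..x, deriv f t ^ 2) - 2 * c * (f x - f y) + c ^ 2 * (x - y) := by
    have he : ∀ t, (deriv f t - c) ^ 2 = deriv f t ^ 2 - 2 * c * deriv f t + c ^ 2 :=
      fun t => by ring
    simp_rw [he]
    rw [intervalIntegral.integral_add, intervalIntegral.integral_sub,
      intervalIntegral.integral_const_mul, hd, intervalIntegral.integral_const, smul_eq_mul]
    · ring
    all_goals exact Continuous.intervalIntegrable (by fun_prop) _ _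
  have hcx : c * (x - y) = f x - f y := div_mul_cancel₀ _ hpos.ne'
  have h2 := mul_nonneg hpos.le (h1 ▸ h0)
  rw [← hcx] at h2 ⊢
  nlinarith

/-- The length `z.1 - z.2` of the oriented interval `(z.2, z.1]` if it contains `t`, else `0`. -/
noncomputable def straddle (t : ℝ) : ℝ × ℝ → ENNReal :=
  {z : ℝ × ℝ | z.2 < t ∧ t ≤ z.1}.indicator fun z => ENNReal.ofReal (z.1 - z.2)

theorem measurable_straddle : Measurable fun q : (ℝ × ℝ) × ℝ => straddle q.2 q.1 := by
  have h : (fun q : (ℝ × ℝ) × ℝ => straddle q.2 q.1) =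
      {q : (ℝ × ℝ) × ℝ | q.1.2 < q.2 ∧ q.2 ≤ q.1.1}.indicator
        fun q => ENNReal.ofReal (q.1.1 - q.1.2) := by
    ext q; simp [straddle, Set.indicator]
  rw [h]
  exact Measurable.indicator (by fun_prop)
    ((measurableSet_lt (measurable_snd.comp measurable_fst) measurable_snd).inter
      (measurableSet_le measurable_snd (measurable_fst.comp measurable_fst)))

theorem ofReal_sq_sub_le_lintegral_deriv_sq {f : ℝ → ℝ} (hf : ContDiff ℝ 1 f) (x y : ℝ) :
    ENNReal.ofReal ((f x - f y) ^ 2) ≤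
      (∫⁻ t, ENNReal.ofReal (deriv f t ^ 2) * straddle t (x, y)) +
      ∫⁻ t, ENNReal.ofReal (deriv f t ^ 2) * straddle t (y, x) := by
  have key : ∀ x y : ℝ, y < x → ENNReal.ofReal ((f x - f y) ^ 2) ≤
      ∫⁻ t, ENNReal.ofReal (deriv f t ^ 2) * straddle t (x, y) := by
    intro x y hxy
    have hc : Continuous (deriv f) := hf.continuous_deriv le_rfl
    have he : ∀ t, ENNReal.ofReal (deriv f t ^ 2) * straddle t (x, y) =
        (Set.Ioc y x).indicator
          (fun t => ENNReal.ofReal (x - y) * ENNReal.ofReal (deriv f t ^ 2)) t := by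
      intro t
      by_cases h : y < t ∧ t ≤ x
      · simp [straddle, Set.indicator, h, mul_comm]
      · simp [straddle, Set.indicator, h]
    simp_rw [he]
    rw [lintegral_indicator measurableSet_Ioc, lintegral_const_mul _ (by fun_prop),
      ← ofReal_integral_eq_lintegral_ofReal, ← ENNReal.ofReal_mul (sub_pos.2 hxy).le,
      ← intervalIntegral.integral_of_le hxy.le]
    · exact ENNReal.ofReal_le_ofReal (sq_sub_le_mul_integral_deriv_sq hf hxy)
    · exact ((hc.pow 2).intervalIntegrable y x).1
    · exact ae_of_all _ fun t => sq_nonneg _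
  rcases lt_trichotomy x y with h | rfl | h
  · rw [sub_sq_comm]
    exact (key y x h).trans le_add_self
  · simp
  · exact (key x y h).trans le_self_add

theorem lintegral_prod_straddle (μ : Measure ℝ) [IsProbabilityMeasure μ] (hint : Integrable id μ)
    (t : ℝ) :
    ∫⁻ z, straddle t z ∂(μ.prod μ) =
      ENNReal.ofReal (∫ x in Set.Ici t, (x - ∫ y, y ∂μ) ∂μ) := by
  have hset : {z : ℝ × ℝ | z.2 < t ∧ t ≤ z.1} = Set.Ici t ×ˢ Set.Iio t := by
    ext z; simp [and_comm]
  have hi : Integrable (fun x : ℝ => x) μ := hint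
  rw [straddle, hset, lintegral_indicator (measurableSet_Ici.prod measurableSet_Iio),
    ← Measure.prod_restrict]
  have hz1 : Integrable (fun z : ℝ × ℝ => z.1)
      ((μ.restrict (Set.Ici t)).prod (μ.restrict (Set.Iio t))) :=
    (hi.restrict).comp_fst _
  have hz2 : Integrable (fun z : ℝ × ℝ => z.2)
      ((μ.restrict (Set.Ici t)).prod (μ.restrict (Set.Iio t))) :=
    (hi.restrict).comp_snd _
  rw [← ofReal_integral_eq_lintegral_ofReal (f := fun z : ℝ × ℝ => z.1 - z.2) (hz1.sub hz2)]
  · congr 1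
    rw [integral_sub hz1 hz2, integral_fun_fst (fun x : ℝ => x), integral_fun_snd (fun x : ℝ => x),
      integral_sub hi.restrict (integrable_const _), integral_const]
    have h1 := integral_add_compl (measurableSet_Ici (a := t)) hi
    have h2 := probReal_add_probReal_compl (μ := μ) (measurableSet_Ici (a := t))
    rw [Set.compl_Ici] at h1 h2
    simp only [measureReal_restrict_apply_univ, smul_eq_mul]
    rw [← h1, ← eq_sub_iff_add_eq'] at *
    rw [h2]; ring
  · rw [Measure.prod_restrict]
    filter_upwards [ae_restrict_mem (measurableSet_Ici.prod measurableSet_Iio)] with z hz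
    have h1 : t ≤ z.1 := hz.1
    have h2 : z.2 < t := hz.2
    simp; linarith

theorem integrable_sq_of_bound {X : Type*} [MeasurableSpace X] {μ : Measure X} [IsFiniteMeasure μ]
    {f : X → ℝ} (hf : AEStronglyMeasurable f μ) {C : ℝ} (hC : ∀ x, |f x| ≤ C) :
    Integrable (fun x => f x ^ 2) μ := by
  refine Integrable.of_bound (hf.pow 2) (C ^ 2) (ae_of_all _ fun x => ?_)
  rw [norm_of_nonneg (sq_nonneg _), ← sq_abs]
  exact pow_le_pow_left₀ (abs_nonneg _) (hC x) 2

/-- A probability measure on `ℝ` satisfies the Poincaré inequality with constant `K` on the class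
of `C¹` functions that are bounded together with their derivative. -/
def PoincareReal (μ : Measure ℝ) (K : ℝ) : Prop :=
  ∀ f : ℝ → ℝ, ContDiff ℝ 1 f → ∀ C : ℝ, (∀ x, |f x| ≤ C) → (∀ x, |deriv f x| ≤ C) →
    ∫ x, f x ^ 2 ∂μ - (∫ x, f x ∂μ) ^ 2 ≤ K * ∫ x, deriv f x ^ 2 ∂μ

theorem poincareReal_of_tail_le {p : ℝ → ℝ} (hp : Measurable p) {K : ℝ} (hK : 0 ≤ K)
    {μ : Measure ℝ} (hμ : μ = volume.withDensity fun t => ENNReal.ofReal (p t))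
    [IsProbabilityMeasure μ] (hint : Integrable id μ)
    (htail : ∀ t, ∫ x in Set.Ici t, (x - ∫ y, y ∂μ) ∂μ ≤ K * p t) :
    PoincareReal μ K := by
  intro f hf C hC hC'
  have hcf : Continuous f := hf.continuous
  have hc : Continuous (deriv f) := hf.continuous_deriv le_rfl
  have hmeas : Measurable fun q : (ℝ × ℝ) × ℝ =>
      ENNReal.ofReal (deriv f q.2 ^ 2) * straddle q.2 q.1 :=
    Measurable.mul (by fun_prop) measurable_straddle
  have hsum : ∫⁻ z, (∫⁻ t, ENNReal.ofReal (deriv f t ^ 2) * straddle t z) ∂(μ.prod μ) ≤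
      ENNReal.ofReal (K * ∫ x, deriv f x ^ 2 ∂μ) := by
    rw [lintegral_lintegral_swap (f := fun z t => ENNReal.ofReal (deriv f t ^ 2) * straddle t z)
      hmeas.aemeasurable]
    have hstep : ∀ t, ∫⁻ z, ENNReal.ofReal (deriv f t ^ 2) * straddle t z ∂(μ.prod μ) ≤
        ENNReal.ofReal K * (ENNReal.ofReal (p t) * ENNReal.ofReal (deriv f t ^ 2)) := by
      intro t
      rw [lintegral_const_mul' _ _ ENNReal.ofReal_ne_top, lintegral_prod_straddle μ hint t,
        ← mul_assoc, ← ENNReal.ofReal_mul hK, mul_comm]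
      gcongr
      exact htail t
    refine (lintegral_mono hstep).trans_eq ?_
    rw [lintegral_const_mul' _ _ ENNReal.ofReal_ne_top, ENNReal.ofReal_mul hK,
      ofReal_integral_eq_lintegral_ofReal]
    · conv_rhs => rw [hμ]
      rw [lintegral_withDensity_eq_lintegral_mul _ (by fun_prop) (by fun_prop)]
      rfl
    · exact integrable_sq_of_bound hc.aestronglyMeasurable hC'
    · exact ae_of_all _ fun t => sq_nonneg _
  have hi : Integrable f μ := Integrable.of_bound (by fun_prop) C (ae_of_all _ hC)
  have hi2 : Integrable (fun x => f x ^ 2) μ :=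
    integrable_sq_of_bound hcf.aestronglyMeasurable hC
  have hvar : ∫ z : ℝ × ℝ, (f z.1 - f z.2) ^ 2 ∂(μ.prod μ) =
      2 * (∫ x, f x ^ 2 ∂μ - (∫ x, f x ∂μ) ^ 2) := by
    have he : ∀ z : ℝ × ℝ, (f z.1 - f z.2) ^ 2 = f z.1 ^ 2 + f z.2 ^ 2 - 2 * (f z.1 * f z.2) :=
      fun z => by ring
    simp_rw [he]
    have h1 : Integrable (fun z : ℝ × ℝ => f z.1 ^ 2) (μ.prod μ) := hi2.comp_fst μ
    have h2 : Integrable (fun z : ℝ × ℝ => f z.2 ^ 2) (μ.prod μ) := hi2.comp_snd μ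
    have h3 : Integrable (fun z : ℝ × ℝ => f z.1 * f z.2) (μ.prod μ) := hi.mul_prod hi
    rw [integral_sub (by fun_prop) (by fun_prop), integral_add h1 h2, integral_const_mul,
      integral_prod_mul, integral_fun_fst (fun x => f x ^ 2), integral_fun_snd (fun x => f x ^ 2)]
    simp; ring
  have hle : ENNReal.ofReal (2 * (∫ x, f x ^ 2 ∂μ - (∫ x, f x ∂μ) ^ 2)) ≤
      ENNReal.ofReal (2 * (K * ∫ x, deriv f x ^ 2 ∂μ)) := by
    rw [← hvar, ofReal_integral_eq_lintegral_ofReal]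
    · set Φ : ℝ × ℝ → ENNReal := fun z => ∫⁻ t, ENNReal.ofReal (deriv f t ^ 2) * straddle t z
        with hΦ
      have hΦm : Measurable Φ := hmeas.lintegral_prod_right'
      calc ∫⁻ z : ℝ × ℝ, ENNReal.ofReal ((f z.1 - f z.2) ^ 2) ∂(μ.prod μ)
          ≤ ∫⁻ z, (Φ z + Φ z.swap) ∂(μ.prod μ) :=
            lintegral_mono fun z => ofReal_sq_sub_le_lintegral_deriv_sq hf z.1 z.2
        _ = ∫⁻ z, Φ z ∂(μ.prod μ) + ∫⁻ z, Φ z.swap ∂(μ.prod μ) := lintegral_add_left hΦm _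
        _ = ∫⁻ z, Φ z ∂(μ.prod μ) + ∫⁻ z, Φ z ∂(μ.prod μ) := by rw [lintegral_prod_swap]
        _ ≤ ENNReal.ofReal (K * ∫ x, deriv f x ^ 2 ∂μ) +
            ENNReal.ofReal (K * ∫ x, deriv f x ^ 2 ∂μ) := add_le_add hsum hsum
        _ = ENNReal.ofReal (2 * (K * ∫ x, deriv f x ^ 2 ∂μ)) := by
          rw [two_mul, ENNReal.ofReal_add] <;>
            exact mul_nonneg hK (integral_nonneg fun _ => sq_nonneg _)
    · refine integrable_sq_of_bound (C := 2 * C) (by fun_prop) fun z => ?_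
      exact (abs_sub _ _).trans (by linarith [hC z.1, hC z.2])
    · exact ae_of_all _ fun t => sq_nonneg _
  have h0 : 0 ≤ 2 * (K * ∫ x, deriv f x ^ 2 ∂μ) :=
    mul_nonneg zero_le_two (mul_nonneg hK (integral_nonneg fun _ => sq_nonneg _))
  linarith [(ENNReal.ofReal_le_ofReal_iff h0).1 hle]

/-- The variance of a bounded function on a product space is subadditive over the factors. -/
theorem variance_prod_le {X Y : Type*} [MeasurableSpace X] [MeasurableSpace Y]
    (μ : Measure X) (ν : Measure Y) [IsProbabilityMeasure μ] [IsProbabilityMeasure ν]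
    {f : X × Y → ℝ} (hf : Measurable f) {C : ℝ} (hC : ∀ z, |f z| ≤ C) :
    ∫ z, f z ^ 2 ∂(μ.prod ν) - (∫ z, f z ∂(μ.prod ν)) ^ 2 ≤
      ∫ y, (∫ x, f (x, y) ^ 2 ∂μ - (∫ x, f (x, y) ∂μ) ^ 2) ∂ν +
      ∫ x, (∫ y, f (x, y) ^ 2 ∂ν - (∫ y, f (x, y) ∂ν) ^ 2) ∂μ := by
  set g : Y → ℝ := fun y => ∫ x, f (x, y) ∂μ with hg
  set h : X → ℝ := fun x => ∫ y, f (x, y) ∂ν with hh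
  set M : ℝ := ∫ z, f z ∂(μ.prod ν) with hM
  have gm : StronglyMeasurable g := hf.stronglyMeasurable.integral_prod_left'
  have hm : StronglyMeasurable h := hf.stronglyMeasurable.integral_prod_right'
  have gC : ∀ y, |g y| ≤ C := fun y => by
    simpa using norm_integral_le_of_norm_le_const (μ := μ)
      (f := fun x => f (x, y)) (ae_of_all _ fun x => hC (x, y))
  have hhC : ∀ x, |h x| ≤ C := fun x => by
    simpa using norm_integral_le_of_norm_le_const (μ := ν)
      (f := fun y => f (x, y)) (ae_of_all _ fun y => hC (x, y))
  have fi : Integrable f (μ.prod ν) :=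
    Integrable.of_bound hf.aestronglyMeasurable C (ae_of_all _ hC)
  have f2 : Integrable (fun z => f z ^ 2) (μ.prod ν) :=
    integrable_sq_of_bound hf.aestronglyMeasurable hC
  have gi : Integrable g ν := Integrable.of_bound gm.aestronglyMeasurable C (ae_of_all _ gC)
  have hi : Integrable h μ := Integrable.of_bound hm.aestronglyMeasurable C (ae_of_all _ hhC)
  have g2 : Integrable (fun y => g y ^ 2) ν := integrable_sq_of_bound gm.aestronglyMeasurable gC
  have h2 : Integrable (fun x => h x ^ 2) μ := integrable_sq_of_bound hm.aestronglyMeasurable hhC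
  have fgi : Integrable (fun z : X × Y => f z * g z.2) (μ.prod ν) :=
    (gi.comp_snd μ).bdd_mul hf.aestronglyMeasurable (ae_of_all _ hC)
  have fhi : Integrable (fun z : X × Y => f z * h z.1) (μ.prod ν) :=
    (hi.comp_fst ν).bdd_mul hf.aestronglyMeasurable (ae_of_all _ hC)
  have hgi : Integrable (fun z : X × Y => h z.1 * g z.2) (μ.prod ν) := hi.mul_prod gi
  have gM : ∫ y, g y ∂ν = M := (integral_prod_symm f fi).symm
  have hhM : ∫ x, h x ∂μ = M := (integral_prod f fi).symm
  have fg : ∫ z : X × Y, f z * g z.2 ∂(μ.prod ν) = ∫ y, g y ^ 2 ∂ν := by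
    rw [integral_prod_symm _ fgi]
    refine integral_congr_ae (ae_of_all _ fun y => ?_)
    simp only [integral_mul_const, sq]; rfl
  have fh : ∫ z : X × Y, f z * h z.1 ∂(μ.prod ν) = ∫ x, h x ^ 2 ∂μ := by
    rw [integral_prod _ fhi]
    refine integral_congr_ae (ae_of_all _ fun x => ?_)
    simp only [integral_mul_const, sq]; rfl
  have hgM : ∫ z : X × Y, h z.1 * g z.2 ∂(μ.prod ν) = M * M := by
    rw [integral_prod_mul, gM, hhM]
  have e1 : ∫ y, (∫ x, f (x, y) ^ 2 ∂μ - g y ^ 2) ∂ν =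
      ∫ z, f z ^ 2 ∂(μ.prod ν) - ∫ y, g y ^ 2 ∂ν := by
    rw [integral_sub f2.integral_prod_right g2, integral_prod_symm _ f2]
  have e2 : ∫ x, (∫ y, f (x, y) ^ 2 ∂ν - h x ^ 2) ∂μ =
      ∫ z, f z ^ 2 ∂(μ.prod ν) - ∫ x, h x ^ 2 ∂μ := by
    rw [integral_sub f2.integral_prod_left h2, integral_prod _ f2]
  clear_value g h M
  have hpos : 0 ≤ ∫ z : X × Y, (f z - g z.2 - h z.1 + M) ^ 2 ∂(μ.prod ν) :=
    integral_nonneg fun _ => sq_nonneg _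
  have hexp : ∫ z : X × Y, (f z - g z.2 - h z.1 + M) ^ 2 ∂(μ.prod ν) =
      ∫ z, f z ^ 2 ∂(μ.prod ν) - ∫ y, g y ^ 2 ∂ν - ∫ x, h x ^ 2 ∂μ + M ^ 2 := by
    have he : ∀ z : X × Y, (f z - g z.2 - h z.1 + M) ^ 2 =
        (f z ^ 2 + g z.2 ^ 2 + h z.1 ^ 2 + 2 * (h z.1 * g z.2) + 2 * M * f z + M ^ 2) -
        (2 * (f z * g z.2) + 2 * (f z * h z.1) + 2 * M * g z.2 + 2 * M * h z.1) :=
      fun z => by ring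
    have g2' : Integrable (fun z : X × Y => g z.2 ^ 2) (μ.prod ν) := g2.comp_snd μ
    have h2' : Integrable (fun z : X × Y => h z.1 ^ 2) (μ.prod ν) := h2.comp_fst ν
    have gi' : Integrable (fun z : X × Y => 2 * M * g z.2) (μ.prod ν) :=
      (gi.comp_snd μ).const_mul _
    have hi' : Integrable (fun z : X × Y => 2 * M * h z.1) (μ.prod ν) :=
      (hi.comp_fst ν).const_mul _
    have hs : Integrable (fun z : X × Y => 2 * (f z * g z.2) + 2 * (f z * h z.1)) (μ.prod ν) := by
      fun_prop
    have hs₁ : Integrable (fun z : X × Y =>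
        2 * (f z * g z.2) + 2 * (f z * h z.1) + 2 * M * g z.2) (μ.prod ν) := hs.add gi'
    have hs₂ : Integrable (fun z : X × Y => 2 * (f z * g z.2) + 2 * (f z * h z.1) +
        2 * M * g z.2 + 2 * M * h z.1) (μ.prod ν) := hs₁.add hi'
    simp_rw [he]
    rw [integral_sub (by fun_prop) hs₂, integral_add (by fun_prop) (by fun_prop),
      integral_add (by fun_prop) (by fun_prop), integral_add (by fun_prop) (by fun_prop),
      integral_add (by fun_prop) (by fun_prop), integral_add (by fun_prop) (by fun_prop),
      integral_add hs₁ hi', integral_add hs gi',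
      integral_add (by fun_prop) (by fun_prop)]
    simp only [integral_const_mul, fg, fh, hgM]
    rw [integral_fun_snd (fun y => g y ^ 2), integral_fun_fst (fun x => h x ^ 2),
      integral_fun_snd g, integral_fun_fst h, gM, hhM, ← hM]
    simp; ring
  rw [hexp] at hpos
  simp only [hg, hh] at e1 e2 hpos
  rw [e1, e2]
  linarith

/-- Tensorization of the one-dimensional Poincaré inequality. -/
theorem poincare_pi {K : ℝ} (n : ℕ) (μ : Fin n → Measure ℝ) [∀ i, IsProbabilityMeasure (μ i)]
    (hμ : ∀ i, PoincareReal (μ i) K) (f : (Fin n → ℝ) → ℝ) (hf : ContDiff ℝ 1 f) (C : ℝ)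
    (hC : ∀ x, |f x| ≤ C) (hC' : ∀ x i, |fderiv ℝ f x (Pi.single i 1)| ≤ C) :
    ∫ x, f x ^ 2 ∂(Measure.pi μ) - (∫ x, f x ∂(Measure.pi μ)) ^ 2 ≤
      K * ∑ i, ∫ x, fderiv ℝ f x (Pi.single i 1) ^ 2 ∂(Measure.pi μ) := by
  induction n with
  | zero =>
    have h : ∀ x, f x = f 0 := fun x => congrArg f (Subsingleton.elim _ _)
    simp [h]
  | succ n ih =>
    have hmp := (measurePreserving_piFinSuccAbove μ 0).symm
    have hcons : ∀ t (y : Fin n → ℝ),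
        (MeasurableEquiv.piFinSuccAbove (fun _ : Fin (n + 1) => ℝ) 0).symm (t, y) =
          Fin.cons t y := fun t y => Fin.insertNth_zero' t y
    set ν : Measure (Fin n → ℝ) := Measure.pi fun j : Fin n => μ (Fin.succAbove 0 j) with hν
    have hfd : Continuous (fderiv ℝ f) := hf.continuous_fderiv one_ne_zero
    have hdiff : Differentiable ℝ f := hf.differentiable one_ne_zero
    have hint : ∀ g : (Fin (n + 1) → ℝ) → ℝ, ∫ x, g x ∂(Measure.pi μ) =
        ∫ z : ℝ × (Fin n → ℝ), g (Fin.cons z.1 z.2) ∂((μ 0).prod ν) := fun g => by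
      rw [← hmp.integral_comp' g]
      simp only [← hcons]
    have hconsc : ContDiff ℝ 1 fun z : ℝ × (Fin n → ℝ) => (Fin.cons z.1 z.2 : Fin (n + 1) → ℝ) := by
      rw [contDiff_pi]
      intro i
      refine Fin.cases ?_ (fun j => ?_) i
      · simpa using contDiff_fst
      · simp only [Fin.cons_succ]; fun_prop
    have hd0 : ∀ t y, HasDerivAt (fun s => f (Fin.cons s y))
        (fderiv ℝ f (Fin.cons t y) (Pi.single 0 1)) t := by
      intro t y
      refine HasFDerivAt.comp_hasDerivAt (f := fun s => (Fin.cons s y : Fin (n + 1) → ℝ)) t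
        (hdiff (Fin.cons t y)).hasFDerivAt ?_
      rw [hasDerivAt_pi]
      intro i
      refine Fin.cases ?_ (fun j => ?_) i
      · simpa using hasDerivAt_id' t
      · simpa using hasDerivAt_const t (y j)
    have hd1 : ∀ t y (i : Fin n), fderiv ℝ (fun y' => f (Fin.cons t y')) y (Pi.single i 1) =
        fderiv ℝ f (Fin.cons t y) (Pi.single i.succ 1) := by
      intro t y i
      have hc : HasFDerivAt (fun y' : Fin n → ℝ => (Fin.cons t y' : Fin (n + 1) → ℝ))
          (ContinuousLinearMap.pi (Fin.cons
            (α := fun _ => (Fin n → ℝ) →L[ℝ] ℝ) 0 fun j => ContinuousLinearMap.proj j)) y := by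
        rw [hasFDerivAt_pi]
        intro j
        refine Fin.cases ?_ (fun j => ?_) j
        · simpa using hasFDerivAt_const t y
        · simpa using hasFDerivAt_apply j y
      have hcomp : fderiv ℝ (fun y' => f (Fin.cons t y')) y = _ :=
        ((hdiff (Fin.cons t y)).hasFDerivAt.comp y hc).fderiv
      rw [hcomp, ContinuousLinearMap.comp_apply]
      congr 1
      ext j
      refine Fin.cases ?_ (fun j => ?_) j
      · simp
      · simp [Pi.single_apply]
    have hmeas : ∀ v, Continuous fun z : ℝ × (Fin n → ℝ) => fderiv ℝ f (Fin.cons z.1 z.2) v :=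
      fun v => (hfd.comp hconsc.continuous).clm_apply continuous_const
    have hsqi : ∀ i, Integrable
        (fun z : ℝ × (Fin n → ℝ) => fderiv ℝ f (Fin.cons z.1 z.2) (Pi.single i 1) ^ 2)
        ((μ 0).prod ν) := fun i =>
      integrable_sq_of_bound (hmeas _).aestronglyMeasurable fun z => hC' _ i
    have hfm : Continuous fun z : ℝ × (Fin n → ℝ) => f (Fin.cons z.1 z.2) :=
      hf.continuous.comp hconsc.continuous
    have hf2i : Integrable (fun z : ℝ × (Fin n → ℝ) => f (Fin.cons z.1 z.2) ^ 2) ((μ 0).prod ν) :=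
      integrable_sq_of_bound hfm.aestronglyMeasurable fun z => hC _
    have hgi : Integrable (fun y => (∫ x, f (Fin.cons x y) ∂(μ 0)) ^ 2) ν :=
      integrable_sq_of_bound (C := C)
        (hfm.stronglyMeasurable.integral_prod_left').aestronglyMeasurable fun y => by
          simpa using norm_integral_le_of_norm_le_const (μ := μ 0)
            (f := fun x => f (Fin.cons x y)) (ae_of_all _ fun x => hC _)
    have hhi : Integrable (fun x => (∫ y, f (Fin.cons x y) ∂ν) ^ 2) (μ 0) :=
      integrable_sq_of_bound (C := C)
        (hfm.stronglyMeasurable.integral_prod_right').aestronglyMeasurable fun x => by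
          simpa using norm_integral_le_of_norm_le_const (μ := ν)
            (f := fun y => f (Fin.cons x y)) (ae_of_all _ fun y => hC _)
    simp_rw [hint]
    refine (variance_prod_le (μ 0) ν hfm.measurable fun z => hC _).trans ?_
    rw [Fin.sum_univ_succ, mul_add]
    refine add_le_add ?_ ?_
    · rw [integral_prod_symm _ (hsqi 0), ← integral_const_mul]
      refine integral_mono (hf2i.integral_prod_right.sub hgi)
        ((hsqi 0).integral_prod_right.const_mul K) fun y => ?_
      have := hμ 0 (fun s => f (Fin.cons s y)) (hf.comp (hconsc.comp (by fun_prop :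
        ContDiff ℝ 1 fun s : ℝ => (s, y)))) C (fun s => hC _)
        (fun s => by rw [(hd0 s y).deriv]; exact hC' _ 0)
      simpa only [(hd0 _ y).deriv] using this
    · have hsum : ∑ i : Fin n, ∫ z : ℝ × (Fin n → ℝ),
          fderiv ℝ f (Fin.cons z.1 z.2) (Pi.single i.succ 1) ^ 2 ∂((μ 0).prod ν) =
          ∫ x, ∑ i : Fin n, ∫ y, fderiv ℝ f (Fin.cons x y) (Pi.single i.succ 1) ^ 2 ∂ν ∂(μ 0) := by
        rw [integral_finsetSum _ fun i _ => (hsqi i.succ).integral_prod_left]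
        exact Finset.sum_congr rfl fun i _ => integral_prod _ (hsqi i.succ)
      rw [hsum, ← integral_const_mul]
      refine integral_mono (hf2i.integral_prod_left.sub hhi)
        ((integrable_finsetSum _ fun i _ => (hsqi i.succ).integral_prod_left).const_mul K)
        fun x => ?_
      have := ih (fun j => μ (Fin.succAbove 0 j)) (fun j => hμ _) (fun y => f (Fin.cons x y))
        (hf.comp (hconsc.comp (by fun_prop : ContDiff ℝ 1 fun y : Fin n → ℝ => (x, y))))
        (fun y => hC _) (fun y i => by rw [hd1]; exact hC' _ _)
      simpa only [hd1] using this

/-- The one-dimensional factor of the monomial Gaussian weight, extended by zero. -/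
noncomputable def monDensity (a lam : ℝ) : ℝ → ℝ :=
  {x : ℝ | 0 < a → 0 < x}.indicator fun x => x ^ a * exp (-x ^ 2 / (2 * lam ^ 2))

theorem measurableSet_imp_pos (a : ℝ) : MeasurableSet {x : ℝ | 0 < a → 0 < x} := by
  by_cases h : 0 < a
  · have hset : {x : ℝ | 0 < a → 0 < x} = Set.Ioi 0 := by ext; simp [h]
    rw [hset]
    exact measurableSet_Ioi
  · simp [h]

theorem measurable_monDensity (a lam : ℝ) : Measurable (monDensity a lam) :=
  Measurable.indicator (by fun_prop) (measurableSet_imp_pos a)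

theorem monDensity_zero (lam x : ℝ) : monDensity 0 lam x = exp (-x ^ 2 / (2 * lam ^ 2)) := by
  simp [monDensity]

theorem monDensity_of_pos {a : ℝ} (ha : 0 < a) (lam : ℝ) :
    monDensity a lam = (Set.Ioi 0).indicator fun x => x ^ a * exp (-x ^ 2 / (2 * lam ^ 2)) := by
  have h : {x : ℝ | 0 < a → 0 < x} = Set.Ioi 0 := by ext; simp [ha]
  rw [monDensity, h]

theorem monDensity_nonneg {a : ℝ} (ha : 0 ≤ a) (lam x : ℝ) : 0 ≤ monDensity a lam x := by
  rcases ha.eq_or_lt with rfl | ha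
  · rw [monDensity_zero]; positivity
  · rw [monDensity_of_pos ha]
    exact Set.indicator_nonneg (fun x hx => mul_nonneg (rpow_nonneg (le_of_lt hx) _)
      (exp_pos _).le) x

theorem neg_sq_div_two_mul_sq (lam x : ℝ) :
    -x ^ 2 / (2 * lam ^ 2) = -(1 / (2 * lam ^ 2)) * x ^ 2 := by ring

theorem integrableOn_rpow_mul_gaussian {s lam : ℝ} (hs : -1 < s) (hlam : 0 < lam) :
    IntegrableOn (fun x : ℝ => x ^ s * exp (-x ^ 2 / (2 * lam ^ 2))) (Set.Ioi 0) := by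
  simp_rw [neg_sq_div_two_mul_sq]
  exact integrableOn_rpow_mul_exp_neg_mul_sq (by positivity) hs

theorem tendsto_rpow_mul_gaussian (s : ℝ) {lam : ℝ} (hlam : 0 < lam) :
    Filter.Tendsto (fun x : ℝ => x ^ s * exp (-x ^ 2 / (2 * lam ^ 2))) Filter.atTop (nhds 0) := by
  simp_rw [neg_sq_div_two_mul_sq]
  refine (rpow_mul_exp_neg_mul_sq_isLittleO_exp_neg (by positivity) s).trans_tendsto ?_
  exact tendsto_exp_atBot.comp (Filter.tendsto_id.const_mul_atTop_of_neg (by norm_num))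

theorem hasDerivAt_gaussian {lam : ℝ} (hlam : 0 < lam) (x : ℝ) :
    HasDerivAt (fun x : ℝ => lam ^ 2 * exp (-x ^ 2 / (2 * lam ^ 2)))
      (-(x * exp (-x ^ 2 / (2 * lam ^ 2)))) x := by
  have h := (((hasDerivAt_pow 2 x).neg.div_const (2 * lam ^ 2)).exp).const_mul (lam ^ 2)
  refine h.congr_deriv ?_
  simp only [Pi.neg_apply]
  field_simp
  simp [mul_comm]

theorem integrable_monDensity {a lam : ℝ} (ha : 0 ≤ a) (hlam : 0 < lam) :
    Integrable (monDensity a lam) := by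
  rcases ha.eq_or_lt with rfl | ha
  · simp_rw [funext (monDensity_zero lam), neg_sq_div_two_mul_sq]
    exact integrable_exp_neg_mul_sq (by positivity)
  · rw [monDensity_of_pos ha, integrable_indicator_iff measurableSet_Ioi]
    exact integrableOn_rpow_mul_gaussian (by linarith) hlam

theorem mul_rpow_mul_gaussian (a lam : ℝ) {x : ℝ} (hx : 0 < x) :
    x * (x ^ a * exp (-x ^ 2 / (2 * lam ^ 2))) = x ^ (a + 1) * exp (-x ^ 2 / (2 * lam ^ 2)) := by
  rw [rpow_add_one hx.ne']; ring

theorem integrableOn_mul_rpow_mul_gaussian {a lam : ℝ} (ha : 0 < a) (hlam : 0 < lam) :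
    IntegrableOn (fun x : ℝ => x * (x ^ a * exp (-x ^ 2 / (2 * lam ^ 2)))) (Set.Ioi 0) :=
  (integrableOn_rpow_mul_gaussian (s := a + 1) (by linarith) hlam).congr_fun
    (fun _ hx => (mul_rpow_mul_gaussian a lam hx).symm) measurableSet_Ioi

theorem mul_monDensity_of_pos {a : ℝ} (ha : 0 < a) (lam : ℝ) (c : ℝ → ℝ) :
    (fun x => c x * monDensity a lam x) =
      (Set.Ioi 0).indicator fun x => c x * (x ^ a * exp (-x ^ 2 / (2 * lam ^ 2))) := by
  ext x
  rw [monDensity_of_pos ha]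
  by_cases hx : x ∈ Set.Ioi (0 : ℝ)
  · simp only [Set.indicator_of_mem hx]
  · simp only [Set.indicator_of_notMem hx, mul_zero]

theorem integrable_mul_monDensity {a lam : ℝ} (ha : 0 ≤ a) (hlam : 0 < lam) :
    Integrable fun x => x * monDensity a lam x := by
  rcases ha.eq_or_lt with rfl | ha
  · simp_rw [monDensity_zero, neg_sq_div_two_mul_sq]
    exact integrable_mul_exp_neg_mul_sq (by positivity)
  · rw [mul_monDensity_of_pos ha, integrable_indicator_iff measurableSet_Ioi]
    exact integrableOn_mul_rpow_mul_gaussian ha hlam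

theorem integral_monDensity_pos {a lam : ℝ} (ha : 0 ≤ a) (hlam : 0 < lam) :
    0 < ∫ x, monDensity a lam x := by
  rw [integral_pos_iff_support_of_nonneg (monDensity_nonneg ha lam)
    (integrable_monDensity ha hlam)]
  have hsub : Set.Ioi (0 : ℝ) ⊆ Function.support (monDensity a lam) := by
    intro x hx
    have hx' : x ∈ {x : ℝ | 0 < a → 0 < x} := fun _ => hx
    rw [Function.mem_support, monDensity, Set.indicator_of_mem hx']
    exact (mul_pos (rpow_pos_of_pos hx _) (exp_pos _)).ne'
  exact lt_of_lt_of_le (by simp) (measure_mono hsub)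

theorem tail_monDensity_zero_le {lam : ℝ} (hlam : 0 < lam) (t : ℝ) :
    ∫ x in Set.Ici t, (x - (∫ y, y * monDensity 0 lam y) / ∫ y, monDensity 0 lam y) *
      monDensity 0 lam x ≤ lam ^ 2 * monDensity 0 lam t := by
  have hi := integrable_mul_monDensity le_rfl hlam
  simp only [monDensity_zero] at hi ⊢
  have hodd : ∫ y, y * exp (-y ^ 2 / (2 * lam ^ 2)) = 0 := by
    have h := integral_neg_eq_self (fun y : ℝ => y * exp (-y ^ 2 / (2 * lam ^ 2))) volume
    simp only [neg_mul, neg_sq, integral_neg] at h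
    linarith
  have htend : Filter.Tendsto (fun x : ℝ => lam ^ 2 * exp (-x ^ 2 / (2 * lam ^ 2)))
      Filter.atTop (nhds 0) := by
    simpa using (tendsto_rpow_mul_gaussian 0 hlam).const_mul (lam ^ 2)
  have h := integral_Ioi_of_hasDerivAt_of_tendsto' (a := t)
    (fun x _ => hasDerivAt_gaussian hlam x) hi.neg.integrableOn htend
  rw [integral_neg] at h
  simp only [hodd, zero_div, sub_zero]
  rw [integral_Ici_eq_integral_Ioi]
  linarith

theorem integral_Ioi_rpow_mul_gaussian {a lam : ℝ} (ha : 0 < a) (hlam : 0 < lam) {t : ℝ}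
    (ht : 0 ≤ t) :
    ∫ x in Set.Ioi t, x * (x ^ a * exp (-x ^ 2 / (2 * lam ^ 2))) =
      lam ^ 2 * (t ^ a * exp (-t ^ 2 / (2 * lam ^ 2))) +
        lam ^ 2 * a * ∫ x in Set.Ioi t, x ^ (a - 1) * exp (-x ^ 2 / (2 * lam ^ 2)) := by
  have hsub : Set.Ioi t ⊆ Set.Ioi 0 := Set.Ioi_subset_Ioi ht
  have hX := (integrableOn_mul_rpow_mul_gaussian ha hlam).mono_set hsub
  have hR := (integrableOn_rpow_mul_gaussian (s := a - 1) (by linarith) hlam).mono_set hsub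
  have htend : Filter.Tendsto (fun x : ℝ => x ^ a * (lam ^ 2 * exp (-x ^ 2 / (2 * lam ^ 2))))
      Filter.atTop (nhds 0) := by
    refine Filter.Tendsto.congr (fun x => mul_left_comm _ _ _) ?_
    simpa using (tendsto_rpow_mul_gaussian a hlam).const_mul (lam ^ 2)
  have hcont : Continuous fun x : ℝ => x ^ a * (lam ^ 2 * exp (-x ^ 2 / (2 * lam ^ 2))) :=
    (continuous_id.rpow_const fun _ => Or.inr ha.le).mul (by fun_prop)
  have hi : IntegrableOn (fun x : ℝ =>
      lam ^ 2 * a * (x ^ (a - 1) * exp (-x ^ 2 / (2 * lam ^ 2))) -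
        x * (x ^ a * exp (-x ^ 2 / (2 * lam ^ 2)))) (Set.Ioi t) :=
    (hR.const_mul (lam ^ 2 * a)).sub hX
  have h := integral_Ioi_of_hasDerivAt_of_tendsto (a := t) hcont.continuousWithinAt
    (fun x hx => ((hasDerivAt_rpow_const (p := a)
      (Or.inl (Set.mem_Ioi.1 (hsub hx)).ne')).mul
      (hasDerivAt_gaussian hlam x)).congr_deriv (by ring)) hi htend
  rw [integral_sub (hR.const_mul _) hX, integral_const_mul] at h
  linarith

theorem tail_monDensity_pos_le {a lam : ℝ} (ha : 0 < a) (hlam : 0 < lam) (t : ℝ) :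
    ∫ x in Set.Ici t, (x - (∫ y, y * monDensity a lam y) / ∫ y, monDensity a lam y) *
      monDensity a lam x ≤ lam ^ 2 * monDensity a lam t := by
  have hZ := integral_monDensity_pos ha.le hlam
  set Z := ∫ y, monDensity a lam y with hZdef
  set m := (∫ y, y * monDensity a lam y) / Z with hm
  set q : ℝ → ℝ := fun x => x ^ a * exp (-x ^ 2 / (2 * lam ^ 2)) with hq
  set r : ℝ → ℝ := fun x => x ^ (a - 1) * exp (-x ^ 2 / (2 * lam ^ 2)) with hr
  have hQi : IntegrableOn q (Set.Ioi 0) := integrableOn_rpow_mul_gaussian (by linarith) hlam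
  have hRi : IntegrableOn r (Set.Ioi 0) := integrableOn_rpow_mul_gaussian (by linarith) hlam
  have hXi : IntegrableOn (fun x => x * q x) (Set.Ioi 0) :=
    integrableOn_mul_rpow_mul_gaussian ha hlam
  have hZ' : Z = ∫ x in Set.Ioi 0, q x := by
    rw [hZdef, monDensity_of_pos ha, integral_indicator measurableSet_Ioi]
  have hX : ∫ y, y * monDensity a lam y = ∫ x in Set.Ioi 0, x * q x := by
    rw [mul_monDensity_of_pos ha, integral_indicator measurableSet_Ioi]
  have hmZ : m * Z = ∫ x in Set.Ioi 0, x * q x := by rw [hm, div_mul_cancel₀ _ hZ.ne', hX]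
  have htail : ∀ s, 0 ≤ s → ∫ x in Set.Ioi s, (x - m) * q x =
      (∫ x in Set.Ioi s, x * q x) - m * ∫ x in Set.Ioi s, q x := by
    intro s hs
    have hsub : Set.Ioi s ⊆ Set.Ioi 0 := Set.Ioi_subset_Ioi hs
    simp_rw [sub_mul]
    rw [integral_sub (hXi.mono_set hsub) ((hQi.mono_set hsub).const_mul m), integral_const_mul]
  rw [integral_Ici_eq_integral_Ioi, mul_monDensity_of_pos ha lam fun x => x - m,
    setIntegral_indicator measurableSet_Ioi, Set.Ioi_inter_Ioi]
  change ∫ x in Set.Ioi (max t 0), (x - m) * q x ≤ _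
  rcases le_or_gt t 0 with ht | ht
  · rw [max_eq_right ht, htail 0 le_rfl, ← hZ', hmZ, sub_self]
    exact mul_nonneg (sq_nonneg _) (monDensity_nonneg ha.le _ _)
  · have hsub : Set.Ioi t ⊆ Set.Ioi 0 := Set.Ioi_subset_Ioi ht.le
    have hsub' : Set.Ioc 0 t ⊆ Set.Ioi 0 := Set.Ioc_subset_Ioi_self
    have hwt : monDensity a lam t = q t := by
      rw [monDensity_of_pos ha, Set.indicator_of_mem (Set.mem_Ioi.2 ht)]
    have hqr : ∀ x, 0 < x → q x = x * r x := fun x hx => by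
      simp only [hq, hr]
      rw [rpow_sub_one hx.ne']
      field_simp
    have hr0 : ∀ x, 0 < x → 0 ≤ r x := fun x hx =>
      mul_nonneg (rpow_nonneg hx.le _) (exp_pos _).le
    have split : ∀ g : ℝ → ℝ, IntegrableOn g (Set.Ioi 0) → ∫ x in Set.Ioi 0, g x =
        (∫ x in Set.Ioc 0 t, g x) + ∫ x in Set.Ioi t, g x := fun g hg => by
      rw [← setIntegral_union (Set.Ioc_disjoint_Ioi le_rfl) measurableSet_Ioi
        (hg.mono_set hsub') (hg.mono_set hsub), Set.Ioc_union_Ioi_eq_Ioi ht.le]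
    have hfar : t * ∫ x in Set.Ioi t, r x ≤ ∫ x in Set.Ioi t, q x := by
      rw [← integral_const_mul]
      refine setIntegral_mono_on ((hRi.mono_set hsub).const_mul t) (hQi.mono_set hsub)
        measurableSet_Ioi fun x hx => ?_
      rw [hqr x (hsub hx)]
      exact mul_le_mul_of_nonneg_right (le_of_lt hx) (hr0 x (hsub hx))
    have hnear : ∫ x in Set.Ioc 0 t, q x ≤ t * ∫ x in Set.Ioc 0 t, r x := by
      rw [← integral_const_mul]
      refine setIntegral_mono_on (hQi.mono_set hsub') ((hRi.mono_set hsub').const_mul t)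
        measurableSet_Ioc fun x hx => ?_
      rw [hqr x hx.1]
      exact mul_le_mul_of_nonneg_right hx.2 (hr0 x hx.1)
    have hfar0 : 0 ≤ ∫ x in Set.Ioi t, r x :=
      setIntegral_nonneg measurableSet_Ioi fun x hx => hr0 x (hsub hx)
    have hnear0 : 0 ≤ ∫ x in Set.Ioc 0 t, r x :=
      setIntegral_nonneg measurableSet_Ioc fun x hx => hr0 x hx.1
    have hXt : ∫ x in Set.Ioi t, x * q x = lam ^ 2 * q t + lam ^ 2 * a * ∫ x in Set.Ioi t, r x :=
      integral_Ioi_rpow_mul_gaussian ha hlam ht.le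
    have hX0 : ∫ x in Set.Ioi 0, x * q x = lam ^ 2 * a * ∫ x in Set.Ioi 0, r x := by
      have h := integral_Ioi_rpow_mul_gaussian ha hlam le_rfl
      rwa [zero_rpow ha.ne', zero_mul, mul_zero, zero_add] at h
    rw [hX0, split r hRi] at hmZ
    rw [split q hQi] at hZ'
    rw [max_eq_left ht.le, htail t ht.le, hXt, hwt]
    suffices h : (lam ^ 2 * a * ∫ x in Set.Ioi t, r x) * Z ≤ m * Z * ∫ x in Set.Ioi t, q x by
      have h' : lam ^ 2 * a * ∫ x in Set.Ioi t, r x ≤ m * ∫ x in Set.Ioi t, q x := by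
        refine le_of_mul_le_mul_right (h.trans_eq ?_) hZ
        ring
      linarith
    rw [hmZ, hZ', mul_assoc, mul_assoc (lam ^ 2 * a)]
    refine mul_le_mul_of_nonneg_left ?_ (by positivity)
    have h1 := mul_le_mul_of_nonneg_left hnear hfar0
    have h2 := mul_le_mul_of_nonneg_left hfar hnear0
    linarith

theorem tail_monDensity_le {a lam : ℝ} (ha : 0 ≤ a) (hlam : 0 < lam) (t : ℝ) :
    ∫ x in Set.Ici t, (x - (∫ y, y * monDensity a lam y) / ∫ y, monDensity a lam y) *
      monDensity a lam x ≤ lam ^ 2 * monDensity a lam t := by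
  rcases ha.eq_or_lt with rfl | ha
  · exact tail_monDensity_zero_le hlam t
  · exact tail_monDensity_pos_le ha hlam t

/-- The measure on `ℝ` with density `monDensity a lam`. -/
noncomputable def monMeasure (a lam : ℝ) : Measure ℝ :=
  volume.withDensity fun x => ENNReal.ofReal (monDensity a lam x)

theorem monMeasure_univ {a lam : ℝ} (ha : 0 ≤ a) (hlam : 0 < lam) :
    monMeasure a lam Set.univ = ENNReal.ofReal (∫ x, monDensity a lam x) := by
  rw [monMeasure, withDensity_apply _ MeasurableSet.univ, Measure.restrict_univ,
    ofReal_integral_eq_lintegral_ofReal (integrable_monDensity ha hlam)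
      (ae_of_all _ (monDensity_nonneg ha lam))]

theorem monMeasure_univ_ne_zero {a lam : ℝ} (ha : 0 ≤ a) (hlam : 0 < lam) :
    monMeasure a lam Set.univ ≠ 0 := by
  rw [monMeasure_univ ha hlam]
  exact (ENNReal.ofReal_pos.2 (integral_monDensity_pos ha hlam)).ne'

theorem monMeasure_univ_ne_top {a lam : ℝ} (ha : 0 ≤ a) (hlam : 0 < lam) :
    monMeasure a lam Set.univ ≠ ⊤ := by
  rw [monMeasure_univ ha hlam]
  exact ENNReal.ofReal_ne_top

/-- The normalization of `monMeasure a lam`. -/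
noncomputable def monProb (a lam : ℝ) : Measure ℝ :=
  (monMeasure a lam Set.univ)⁻¹ • monMeasure a lam

theorem isProbabilityMeasure_monProb {a lam : ℝ} (ha : 0 ≤ a) (hlam : 0 < lam) :
    IsProbabilityMeasure (monProb a lam) :=
  ⟨by simpa [monProb] using
    ENNReal.inv_mul_cancel (monMeasure_univ_ne_zero ha hlam) (monMeasure_univ_ne_top ha hlam)⟩

theorem monProb_eq_withDensity {a lam : ℝ} (ha : 0 ≤ a) (hlam : 0 < lam) :
    monProb a lam = volume.withDensity fun x =>
      ENNReal.ofReal ((∫ y, monDensity a lam y)⁻¹ * monDensity a lam x) := by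
  have hZ := integral_monDensity_pos ha hlam
  rw [monProb, monMeasure_univ ha hlam, monMeasure,
    ← withDensity_smul _ (measurable_monDensity a lam).ennreal_ofReal]
  congr 1
  ext x
  rw [ENNReal.ofReal_mul (inv_nonneg.2 hZ.le), ENNReal.ofReal_inv_of_pos hZ]
  rfl

theorem poincareReal_monProb {a lam : ℝ} (ha : 0 ≤ a) (hlam : 0 < lam) :
    PoincareReal (monProb a lam) (lam ^ 2) := by
  have := isProbabilityMeasure_monProb ha hlam
  have hZ := integral_monDensity_pos ha hlam
  have hp : Measurable fun x => (∫ y, monDensity a lam y)⁻¹ * monDensity a lam x :=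
    (measurable_monDensity a lam).const_mul _
  have hp0 : ∀ x, 0 ≤ (∫ y, monDensity a lam y)⁻¹ * monDensity a lam x := fun x =>
    mul_nonneg (inv_nonneg.2 hZ.le) (monDensity_nonneg ha lam x)
  have hμ := monProb_eq_withDensity ha hlam
  refine poincareReal_of_tail_le hp (sq_nonneg _) hμ ?_ fun t => ?_
  · rw [hμ, integrable_withDensity_iff_integrable_smul' hp.ennreal_ofReal
      (ae_of_all _ fun _ => ENNReal.ofReal_lt_top)]
    simp only [ENNReal.toReal_ofReal (hp0 _), id, smul_eq_mul]
    refine ((integrable_mul_monDensity ha hlam).const_mul (∫ y, monDensity a lam y)⁻¹).congr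
      (ae_of_all _ fun x => ?_)
    simp only
    ring
  · rw [hμ, integral_withDensity_eq_integral_toReal_smul hp.ennreal_ofReal
      (ae_of_all _ fun _ => ENNReal.ofReal_lt_top),
      setIntegral_withDensity_eq_setIntegral_toReal_smul hp.ennreal_ofReal
      (ae_of_all _ fun _ => ENNReal.ofReal_lt_top) _ measurableSet_Ici]
    simp only [ENNReal.toReal_ofReal (hp0 _), smul_eq_mul]
    have hm : ∫ x, (∫ y, monDensity a lam y)⁻¹ * monDensity a lam x * x =
        (∫ y, y * monDensity a lam y) / ∫ y, monDensity a lam y := by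
      rw [div_eq_inv_mul, ← integral_const_mul]
      exact integral_congr_ae (ae_of_all _ fun x => by simp only; ring)
    rw [hm]
    calc _ = (∫ y, monDensity a lam y)⁻¹ * ∫ x in Set.Ici t,
          (x - (∫ y, y * monDensity a lam y) / ∫ y, monDensity a lam y) * monDensity a lam x := by
          rw [← integral_const_mul]
          exact integral_congr_ae (ae_of_all _ fun x => by simp only; ring)
      _ ≤ (∫ y, monDensity a lam y)⁻¹ * (lam ^ 2 * monDensity a lam t) :=
          mul_le_mul_of_nonneg_left (tail_monDensity_le ha hlam t) (inv_nonneg.2 hZ.le)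
      _ = _ := by ring

theorem pi_withDensity_ofReal {ι : Type*} [Fintype ι] {w : ι → ℝ → ℝ}
    (hw : ∀ i, Integrable (w i)) (hw0 : ∀ i x, 0 ≤ w i x) :
    Measure.pi (fun i => volume.withDensity fun x => ENNReal.ofReal (w i x)) =
      (volume : Measure (ι → ℝ)).withDensity fun x => ENNReal.ofReal (∏ i, w i (x i)) := by
  refine Measure.pi_eq fun s hs => ?_
  rw [withDensity_apply _ (MeasurableSet.univ_pi hs), volume_pi, Measure.restrict_pi_pi,
    ← ofReal_integral_eq_lintegral_ofReal
      (Integrable.fintype_prod fun i => (hw i).restrict)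
      (ae_of_all _ fun x => Finset.prod_nonneg fun i _ => hw0 i _),
    integral_fintype_prod_eq_prod, ENNReal.ofReal_prod_of_nonneg
      fun i _ => integral_nonneg (hw0 i)]
  refine Finset.prod_congr rfl fun i _ => ?_
  rw [withDensity_apply _ (hs i),
    ofReal_integral_eq_lintegral_ofReal (hw i).restrict (ae_of_all _ (hw0 i))]

theorem measurableSet_chamber {N : ℕ} (α : Fin N → ℝ) : MeasurableSet (chamber α) := by
  have h : chamber α = ⋂ i, (fun x : EuclideanSpace ℝ (Fin N) => x i) ⁻¹'
      {y : ℝ | 0 < α i → 0 < y} := by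
    ext x; simp [chamber]
  rw [h]
  exact MeasurableSet.iInter fun i => (measurableSet_imp_pos (α i)).preimage (by fun_prop)

theorem indicator_chamber_toLp {N : ℕ} (α : Fin N → ℝ) (lam : ℝ) (x : Fin N → ℝ) :
    (chamber α).indicator (fun x => ENNReal.ofReal
        (monWeight α x * Real.exp (-‖x‖ ^ 2 / (2 * lam ^ 2)))) (WithLp.toLp 2 x) =
      ENNReal.ofReal (∏ i, monDensity (α i) lam (x i)) := by
  by_cases hx : WithLp.toLp 2 x ∈ chamber α
  · rw [Set.indicator_of_mem hx]
    have hxi : ∀ i, x i ∈ {y : ℝ | 0 < α i → 0 < y} := hx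
    simp only [monDensity, Set.indicator_of_mem (hxi _), Finset.prod_mul_distrib, monWeight,
      EuclideanSpace.real_norm_sq_eq, ← Real.exp_sum, ← Finset.sum_div, Finset.sum_neg_distrib]
  · rw [Set.indicator_of_notMem hx]
    obtain ⟨i, hi⟩ : ∃ i, x i ∉ {y : ℝ | 0 < α i → 0 < y} := by
      by_contra! h
      exact hx h
    have h0 : monDensity (α i) lam (x i) = 0 := Set.indicator_of_notMem hi _
    rw [Finset.prod_eq_zero (Finset.mem_univ i) h0, ENNReal.ofReal_zero]

theorem map_toLp_pi_monMeasure {N : ℕ} {α : Fin N → ℝ} (hα : ∀ i, 0 ≤ α i) {lam : ℝ}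
    (hlam : 0 < lam) :
    (Measure.pi fun i => monMeasure (α i) lam).map (MeasurableEquiv.toLp 2 (Fin N → ℝ)) =
      (volume.restrict (chamber α)).withDensity (fun x => ENNReal.ofReal
        (monWeight α x * Real.exp (-‖x‖ ^ 2 / (2 * lam ^ 2)))) := by
  simp only [monMeasure]
  rw [pi_withDensity_ofReal (fun i => integrable_monDensity (hα i) hlam)
    (fun i => monDensity_nonneg (hα i) lam), ← withDensity_indicator (measurableSet_chamber α)]
  ext s hs
  rw [MeasurableEquiv.map_apply, withDensity_apply _ hs,
    withDensity_apply _ ((MeasurableEquiv.toLp 2 (Fin N → ℝ)).measurable hs),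
    ← (PiLp.volume_preserving_toLp (Fin N)).setLIntegral_comp_preimage_emb
      (MeasurableEquiv.toLp 2 (Fin N → ℝ)).measurableEmbedding]
  exact lintegral_congr fun x => (indicator_chamber_toLp α lam x).symm

theorem monGaussScaled_eq_map {N : ℕ} {α : Fin N → ℝ} (hα : ∀ i, 0 ≤ α i) {lam : ℝ}
    (hlam : 0 < lam) :
    monGaussScaled α lam =
      (Measure.pi fun i => monProb (α i) lam).map (MeasurableEquiv.toLp 2 (Fin N → ℝ)) := by
  have := fun i => isProbabilityMeasure_monProb (hα i) hlam
  have hfin : ∀ i, IsFiniteMeasure (monMeasure (α i) lam) := fun i =>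
    ⟨(monMeasure_univ_ne_top (hα i) hlam).lt_top⟩
  have hpi : Measure.pi (fun i => monProb (α i) lam) =
      (∏ i, monMeasure (α i) lam Set.univ)⁻¹ • Measure.pi fun i => monMeasure (α i) lam := by
    refine Measure.pi_eq fun s hs => ?_
    simp only [monProb, Measure.smul_apply, smul_eq_mul, Measure.pi_pi, Finset.prod_mul_distrib]
    rw [ENNReal.prod_inv_distrib]
    exact fun i _ j _ _ => Or.inl (monMeasure_univ_ne_zero (hα i) hlam)
  rw [hpi, Measure.map_smul, map_toLp_pi_monMeasure hα hlam, monGaussScaled]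
  congr 2
  rw [← map_toLp_pi_monMeasure hα hlam, MeasurableEquiv.map_apply, Set.preimage_univ,
    Measure.pi_univ]

theorem norm_gradient_sq_eq_sum {N : ℕ} (u : EuclideanSpace ℝ (Fin N) → ℝ)
    (x : EuclideanSpace ℝ (Fin N)) :
    ‖gradient u x‖ ^ 2 = ∑ i, fderiv ℝ u x (EuclideanSpace.single i 1) ^ 2 := by
  rw [EuclideanSpace.real_norm_sq_eq]
  refine Finset.sum_congr rfl fun i _ => ?_
  rw [← inner_gradient_left, EuclideanSpace.inner_single_right]
  simp

/-- Scale-dependent Poincaré inequality with monomial Gaussian weight: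
`∫|∇u|² dμ_{A,λ} ≥ (1/λ²) inf_c ∫ |u − c|² dμ_{A,λ}`. -/
theorem scale_poincare_monomial_gaussian {N : ℕ} (hN : 1 ≤ N) (α : Fin N → ℝ)
    (hα : ∀ i, 0 ≤ α i) (lam : ℝ) (hlam : 0 < lam)
    (u : EuclideanSpace ℝ (Fin N) → ℝ) (hu : NstarClass α u) :
    ∫ x, ‖gradient u x‖ ^ 2 ∂(monGaussScaled α lam) ≥
      (1 / lam ^ 2) * ⨅ c : ℝ, ∫ x, (u x - c) ^ 2 ∂(monGaussScaled α lam) := by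
  obtain ⟨hsmooth, hcs, -⟩ := hu
  have hu1 : ContDiff ℝ 1 u := hsmooth.of_le (by exact_mod_cast le_top)
  have := fun i => isProbabilityMeasure_monProb (hα i) hlam
  set P : Measure (Fin N → ℝ) := Measure.pi fun i => monProb (α i) lam with hP
  have hint : ∀ g : EuclideanSpace ℝ (Fin N) → ℝ, ∫ x, g x ∂(monGaussScaled α lam) =
      ∫ x, g (WithLp.toLp 2 x) ∂P := fun g => by
    rw [monGaussScaled_eq_map hα hlam, integral_map_equiv]
    rfl
  set L : (Fin N → ℝ) →L[ℝ] EuclideanSpace ℝ (Fin N) :=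
    ((EuclideanSpace.equiv (Fin N) ℝ).symm : (Fin N → ℝ) →L[ℝ] EuclideanSpace ℝ (Fin N)) with hL
  set f : (Fin N → ℝ) → ℝ := fun x => u (WithLp.toLp 2 x) with hf
  have hfc : ContDiff ℝ 1 f := hu1.comp L.contDiff
  have hfd : ∀ x i, fderiv ℝ f x (Pi.single i 1) =
      fderiv ℝ u (WithLp.toLp 2 x) (EuclideanSpace.single i 1) := fun x i => by
    have h : fderiv ℝ f x = _ := ((hu1.differentiable one_ne_zero (L x)).hasFDerivAt.comp x
      L.hasFDerivAt).fderiv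
    rw [h]
    rfl
  obtain ⟨C₀, hC₀⟩ := hcs.exists_bound_of_continuous hu1.continuous
  obtain ⟨C₁, hC₁⟩ := (hcs.fderiv ℝ).exists_bound_of_continuous
    (hu1.continuous_fderiv one_ne_zero)
  have hfC : ∀ x, |f x| ≤ max C₀ C₁ := fun x => (hC₀ _).trans (le_max_left _ _)
  have hfC' : ∀ x i, |fderiv ℝ f x (Pi.single i 1)| ≤ max C₀ C₁ := fun x i => by
    rw [hfd]
    refine (((fderiv ℝ u _).le_opNorm _).trans ?_).trans (le_max_right C₀ C₁)
    simpa using hC₁ (WithLp.toLp 2 x)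
  have hpoinc := poincare_pi N (fun i => monProb (α i) lam)
    (fun i => poincareReal_monProb (hα i) hlam) f hfc (max C₀ C₁) hfC hfC'
  rw [← hP] at hpoinc
  have hgrad : ∫ x, ‖gradient u x‖ ^ 2 ∂(monGaussScaled α lam) =
      ∑ i, ∫ x, fderiv ℝ f x (Pi.single i 1) ^ 2 ∂P := by
    rw [hint, ← integral_finsetSum]
    · simp only [norm_gradient_sq_eq_sum, hfd]
    · exact fun i _ => integrable_sq_of_bound ((hfc.continuous_fderiv one_ne_zero).clm_apply
        continuous_const).aestronglyMeasurable fun x => hfC' x i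
  have hfi : Integrable f P := Integrable.of_bound hfc.continuous.aestronglyMeasurable _
    (ae_of_all _ hfC)
  have hf2i : Integrable (fun x => f x ^ 2) P :=
    integrable_sq_of_bound hfc.continuous.aestronglyMeasurable hfC
  have hvar : ∫ x, (u x - ∫ y, f y ∂P) ^ 2 ∂(monGaussScaled α lam) =
      ∫ x, f x ^ 2 ∂P - (∫ x, f x ∂P) ^ 2 := by
    rw [hint]
    change ∫ x, (f x - ∫ y, f y ∂P) ^ 2 ∂P = _
    have he : ∀ x, (f x - ∫ y, f y ∂P) ^ 2 =
        f x ^ 2 - 2 * (∫ y, f y ∂P) * f x + (∫ y, f y ∂P) ^ 2 := fun x => by ring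
    simp_rw [he]
    rw [integral_add (by fun_prop) (by fun_prop), integral_sub (by fun_prop) (by fun_prop),
      integral_const_mul]
    simp
    ring
  have hinf : ⨅ c : ℝ, ∫ x, (u x - c) ^ 2 ∂(monGaussScaled α lam) ≤
      ∫ x, f x ^ 2 ∂P - (∫ x, f x ∂P) ^ 2 := by
    rw [← hvar]
    refine ciInf_le ⟨0, ?_⟩ (∫ y, f y ∂P)
    rintro _ ⟨c, rfl⟩
    exact integral_nonneg fun _ => sq_nonneg _
  rw [ge_iff_le, one_div, inv_mul_le_iff₀ (by positivity), hgrad]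
  exact hinf.trans hpoinc
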